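/- As x → ∞, ∫_1^{x^{1/4}} f₁(t) dt = (3x)^{1/2}·G₁(0) − 3^{4/3}·2^{−2/3}·x^{1/3} + O(x^{−1/3}). -/

import Mathlib

open Real Filter Asymptotics

/-- f₁(t) = t·[(3x/t⁴ + √((3x/t⁴)² − 1/27))^{1/3} + (3x/t⁴ − √((3x/t⁴)² − 1/27))^{1/3}]. -/
noncomputable def f1 (x t : ℝ) : ℝ :=
  t * ((3 * x / t ^ 4 + Real.sqrt ((3 * x / t ^ 4) ^ 2 - 1/27)) ^ ((1:ℝ)/3)
    + (3 * x / t ^ 4 - Real.sqrt ((3 * x / t ^ 4) ^ 2 - 1/27)) ^ ((1:ℝ)/3))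

/-- G₁(y) = ∫_y^{3^{−1/4}} t^{−1/3}·[(1 + √(1 − t⁸/27))^{1/3} + (1 − √(1 − t⁸/27))^{1/3}] dt. -/
noncomputable def G1 (y : ℝ) : ℝ :=
  ∫ t in y..(3:ℝ) ^ (-(1:ℝ)/4),
    t ^ (-(1:ℝ)/3) * ((1 + Real.sqrt (1 - t ^ 8 / 27)) ^ ((1:ℝ)/3)
      + (1 - Real.sqrt (1 - t ^ 8 / 27)) ^ ((1:ℝ)/3))

/-- The bounded factor `(1 + √(1 − u⁸/27))^{1/3} + (1 − √(1 − u⁸/27))^{1/3}` of the integrand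
of `G1`. -/
noncomputable def cardanoSum (u : ℝ) : ℝ :=
  (1 + Real.sqrt (1 - u ^ 8 / 27)) ^ ((1:ℝ)/3) + (1 - Real.sqrt (1 - u ^ 8 / 27)) ^ ((1:ℝ)/3)

lemma sqrt_one_sub_le_one (u : ℝ) : Real.sqrt (1 - u ^ 8 / 27) ≤ 1 := by
  have : 0 ≤ u ^ 8 := by positivity
  exact Real.sqrt_le_one.mpr (by linarith)

lemma continuous_cardanoSum : Continuous cardanoSum := by
  unfold cardanoSum
  refine Continuous.add ?_ ?_ <;>
    exact Continuous.rpow_const (by fun_prop) fun _ => Or.inr (by norm_num)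

lemma intervalIntegrable_rpow_mul_cardanoSum (a b : ℝ) :
    IntervalIntegrable (fun u : ℝ => u ^ (-(1:ℝ)/3) * cardanoSum u) MeasureTheory.volume a b :=
  (intervalIntegral.intervalIntegrable_rpow' (by norm_num)).mul_continuousOn
    continuous_cardanoSum.continuousOn

lemma G1_eq (y : ℝ) :
    G1 y = ∫ u in y..(3:ℝ) ^ (-(1:ℝ)/4), u ^ (-(1:ℝ)/3) * cardanoSum u := rfl

lemma f1_mul_eq {x c u : ℝ} (hx : 0 < x) (hc : c ^ 4 = 3 * x) (hu : 0 < u) :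
    f1 x (c * u) = c * (u ^ (-(1:ℝ)/3) * cardanoSum u) := by
  have hq : 3 * x / (c * u) ^ 4 = (u ^ 4)⁻¹ := by
    rw [mul_pow, hc]
    field_simp
  have hs : Real.sqrt (((u ^ 4)⁻¹) ^ 2 - 1/27)
      = (u ^ 4)⁻¹ * Real.sqrt (1 - u ^ 8 / 27) := by
    rw [show ((u ^ 4)⁻¹) ^ 2 - 1/27 = ((u ^ 4)⁻¹) ^ 2 * (1 - u ^ 8 / 27) by field_simp,
      Real.sqrt_mul (by positivity), Real.sqrt_sq (by positivity)]
  have hp : u * ((u ^ 4)⁻¹) ^ ((1:ℝ)/3) = u ^ (-(1:ℝ)/3) := by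
    rw [← Real.rpow_natCast, ← Real.rpow_neg hu.le, ← Real.rpow_mul hu.le]
    nth_rewrite 1 [← Real.rpow_one u]
    rw [← Real.rpow_add hu]
    norm_num
  have hr := sqrt_one_sub_le_one u
  rw [f1, hq, hs, cardanoSum, ← hp]
  set r := Real.sqrt (1 - u ^ 8 / 27)
  have hr0 : 0 ≤ r := Real.sqrt_nonneg _
  rw [show (u ^ 4)⁻¹ + (u ^ 4)⁻¹ * r = (u ^ 4)⁻¹ * (1 + r) by ring,
    show (u ^ 4)⁻¹ - (u ^ 4)⁻¹ * r = (u ^ 4)⁻¹ * (1 - r) by ring,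
    Real.mul_rpow (by positivity) (by linarith), Real.mul_rpow (by positivity) (by linarith)]
  ring

lemma abs_cardanoSum_sub_le {u : ℝ} (hu : 0 ≤ u) (hu1 : u ≤ 1) :
    |cardanoSum u - 2 ^ ((1:ℝ)/3)| ≤ u ^ ((8:ℝ)/3) := by
  have h8 : u ^ 8 ≤ 1 := pow_le_one₀ hu hu1
  have h8' : 0 ≤ u ^ 8 := by positivity
  have hr := sqrt_one_sub_le_one u
  have hsq := Real.sq_sqrt (show 0 ≤ 1 - u ^ 8 / 27 by linarith)
  rw [cardanoSum]
  set r := Real.sqrt (1 - u ^ 8 / 27)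
  have hr0 : 0 ≤ r := Real.sqrt_nonneg _
  have h1r : 1 - r ≤ u ^ 8 := by nlinarith
  have hsmall : (1 - r) ^ ((1:ℝ)/3) ≤ u ^ ((8:ℝ)/3) := by
    calc (1 - r) ^ ((1:ℝ)/3) ≤ (u ^ 8) ^ ((1:ℝ)/3) :=
          Real.rpow_le_rpow (by linarith) h1r (by norm_num)
      _ = u ^ ((8:ℝ)/3) := by
          rw [← Real.rpow_natCast, ← Real.rpow_mul hu]
          norm_num
  have hsub : (2:ℝ) ^ ((1:ℝ)/3) ≤ (1 + r) ^ ((1:ℝ)/3) + (1 - r) ^ ((1:ℝ)/3) := by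
    have := Real.rpow_add_le_add_rpow (show 0 ≤ 1 + r by linarith) (show 0 ≤ 1 - r by linarith)
      (show (0:ℝ) ≤ 1/3 by norm_num) (by norm_num)
    rwa [show 1 + r + (1 - r) = 2 by ring] at this
  have hmono : (1 + r) ^ ((1:ℝ)/3) ≤ (2:ℝ) ^ ((1:ℝ)/3) :=
    Real.rpow_le_rpow (by linarith) (by linarith) (by norm_num)
  rw [abs_le]
  constructor
  · have : 0 ≤ u ^ ((8:ℝ)/3) := by positivity
    linarith
  · linarith

lemma abs_integral_rpow_mul_cardanoSum_sub_le {ε : ℝ} (hε : 0 < ε) (hε1 : ε ≤ 1) :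
    |(∫ u in (0:ℝ)..ε, u ^ (-(1:ℝ)/3) * cardanoSum u)
      - 2 ^ ((1:ℝ)/3) * (3/2) * ε ^ ((2:ℝ)/3)| ≤ ε ^ ((10:ℝ)/3) := by
  have hmain : ∫ u in (0:ℝ)..ε, u ^ (-(1:ℝ)/3) * 2 ^ ((1:ℝ)/3)
      = 2 ^ ((1:ℝ)/3) * (3/2) * ε ^ ((2:ℝ)/3) := by
    rw [intervalIntegral.integral_mul_const, integral_rpow (Or.inl (by norm_num)),
      show -(1:ℝ)/3 + 1 = 2/3 by norm_num, Real.zero_rpow (by norm_num)]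
    ring
  rw [← hmain, ← intervalIntegral.integral_sub (intervalIntegrable_rpow_mul_cardanoSum 0 ε)
    ((intervalIntegral.intervalIntegrable_rpow' (by norm_num)).mul_const _)]
  have hbound : ∀ u ∈ Set.uIoc 0 ε,
      ‖u ^ (-(1:ℝ)/3) * cardanoSum u - u ^ (-(1:ℝ)/3) * 2 ^ ((1:ℝ)/3)‖ ≤ ε ^ ((7:ℝ)/3) := by
    intro u hu
    rw [Set.uIoc_of_le hε.le] at hu
    obtain ⟨hu0, huε⟩ := hu
    rw [← mul_sub, norm_mul, Real.norm_eq_abs, Real.norm_eq_abs,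
      abs_of_nonneg (Real.rpow_nonneg hu0.le _)]
    calc u ^ (-(1:ℝ)/3) * |cardanoSum u - 2 ^ ((1:ℝ)/3)|
        ≤ u ^ (-(1:ℝ)/3) * u ^ ((8:ℝ)/3) := by
          gcongr
          exact abs_cardanoSum_sub_le hu0.le (huε.trans hε1)
      _ = u ^ ((7:ℝ)/3) := by
          rw [← Real.rpow_add hu0]
          norm_num
      _ ≤ ε ^ ((7:ℝ)/3) := Real.rpow_le_rpow hu0.le huε (by norm_num)
  refine (intervalIntegral.norm_integral_le_of_norm_le_const hbound).trans_eq ?_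
  rw [sub_zero, abs_of_pos hε]
  nth_rewrite 2 [← Real.rpow_one ε]
  rw [← Real.rpow_add hε]
  norm_num

lemma integral_f1_eq {x : ℝ} (hx : 0 < x) :
    ∫ t in (1:ℝ)..x ^ ((1:ℝ)/4), f1 x t
      = (3 * x) ^ ((1:ℝ)/2) *
        (G1 0 - ∫ u in (0:ℝ)..(3 * x) ^ (-(1:ℝ)/4), u ^ (-(1:ℝ)/3) * cardanoSum u) := by
  have h3x : 0 < 3 * x := by positivity
  set c : ℝ := (3 * x) ^ ((1:ℝ)/4) with hcdef
  have hc4 : c ^ 4 = 3 * x := by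
    rw [hcdef, ← Real.rpow_natCast, ← Real.rpow_mul h3x.le]
    norm_num
  have hc2 : c * c = (3 * x) ^ ((1:ℝ)/2) := by
    rw [hcdef, ← Real.rpow_add h3x]
    norm_num
  have hlow : c * (3 * x) ^ (-(1:ℝ)/4) = 1 := by
    rw [hcdef, ← Real.rpow_add h3x]
    norm_num
  have hupp : c * (3:ℝ) ^ (-(1:ℝ)/4) = x ^ ((1:ℝ)/4) := by
    rw [hcdef, Real.mul_rpow (by norm_num) hx.le, mul_right_comm,
      ← Real.rpow_add (by norm_num)]
    norm_num
  have hcongr : ∫ u in (3 * x) ^ (-(1:ℝ)/4)..(3:ℝ) ^ (-(1:ℝ)/4), f1 x (c * u)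
      = ∫ u in (3 * x) ^ (-(1:ℝ)/4)..(3:ℝ) ^ (-(1:ℝ)/4),
        c * (u ^ (-(1:ℝ)/3) * cardanoSum u) := by
    refine intervalIntegral.integral_congr fun u hu => f1_mul_eq hx hc4 ?_
    exact (lt_min (by positivity) (by positivity)).trans_le hu.1
  rw [G1_eq, intervalIntegral.integral_interval_sub_left
    (intervalIntegrable_rpow_mul_cardanoSum _ _) (intervalIntegrable_rpow_mul_cardanoSum _ _),
    ← hc2, mul_assoc, ← intervalIntegral.integral_const_mul, ← hcongr,
    intervalIntegral.mul_integral_comp_mul_left, hlow, hupp]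

theorem integral_f1_asymptotic :
    (fun x : ℝ => (∫ t in (1:ℝ)..x ^ ((1:ℝ)/4), f1 x t)
        - (3 * x) ^ ((1:ℝ)/2) * G1 0
        + 3 ^ ((4:ℝ)/3) * 2 ^ (-(2:ℝ)/3) * x ^ ((1:ℝ)/3))
      =O[atTop] fun x : ℝ => x ^ (-(1:ℝ)/3) := by
  refine IsBigO.of_bound 1 ?_
  filter_upwards [eventually_ge_atTop 1] with x hx1
  have hx : 0 < x := by linarith
  have h3x : 0 < 3 * x := by positivity
  set ε : ℝ := (3 * x) ^ (-(1:ℝ)/4) with hεdef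
  have hε : 0 < ε := by positivity
  have hε1 : ε ≤ 1 := Real.rpow_le_one_of_one_le_of_nonpos (by linarith) (by norm_num)
  have hmain : (3 * x) ^ ((1:ℝ)/2) * (2 ^ ((1:ℝ)/3) * (3/2) * ε ^ ((2:ℝ)/3))
      = 3 ^ ((4:ℝ)/3) * 2 ^ (-(2:ℝ)/3) * x ^ ((1:ℝ)/3) := by
    have h2 : (2:ℝ) ^ ((1:ℝ)/3) = 2 ^ (-(2:ℝ)/3) * 2 := by
      rw [← Real.rpow_add_one (by norm_num)]
      norm_num
    have h3 : (3:ℝ) ^ ((4:ℝ)/3) = 3 ^ ((1:ℝ)/3) * 3 := by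
      rw [← Real.rpow_add_one (by norm_num)]
      norm_num
    have hpow : (3 * x) ^ ((1:ℝ)/2) * ε ^ ((2:ℝ)/3) = 3 ^ ((1:ℝ)/3) * x ^ ((1:ℝ)/3) := by
      rw [hεdef, ← Real.rpow_mul h3x.le, ← Real.rpow_add h3x,
        ← Real.mul_rpow (by norm_num) hx.le]
      norm_num
    rw [h2, h3]
    linear_combination (2 ^ (-(2:ℝ)/3) * 3) * hpow
  have herr : (3 * x) ^ ((1:ℝ)/2) * ε ^ ((10:ℝ)/3) = (3 * x) ^ (-(1:ℝ)/3) := by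
    rw [hεdef, ← Real.rpow_mul h3x.le, ← Real.rpow_add h3x]
    norm_num
  rw [integral_f1_eq hx, ← hmain, one_mul, Real.norm_eq_abs, Real.norm_eq_abs,
    abs_of_nonneg (Real.rpow_nonneg hx.le _)]
  set I := ∫ u in (0:ℝ)..ε, u ^ (-(1:ℝ)/3) * cardanoSum u
  rw [show ∀ a b m : ℝ, a * (b - I) - a * b + a * m = -(a * (I - m)) by intros; ring,
    abs_neg, abs_mul, abs_of_nonneg (Real.rpow_nonneg h3x.le _)]
  calc (3 * x) ^ ((1:ℝ)/2) * |I - 2 ^ ((1:ℝ)/3) * (3/2) * ε ^ ((2:ℝ)/3)|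
      ≤ (3 * x) ^ ((1:ℝ)/2) * ε ^ ((10:ℝ)/3) := by
        gcongr
        exact abs_integral_rpow_mul_cardanoSum_sub_le hε hε1
    _ = (3 * x) ^ (-(1:ℝ)/3) := herr
    _ ≤ x ^ (-(1:ℝ)/3) :=
        Real.rpow_le_rpow_of_nonpos hx (by linarith) (by norm_num)
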